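/- Let F be a finite field and let G be a k×n matrix over F whose rows are linearly independent, generating the linear code C ⊆ F^n (the row space of G). Then the dimension of Hull(C) equals k − rank(G·Gᵀ). -/

import Mathlib

open Matrix

/-- The dual code of a linear code `C ⊆ F^n` with respect to the standard dot product. -/
def dualCode (F : Type*) [Field F] {n : ℕ} (C : Submodule F (Fin n → F)) :
    Submodule F (Fin n → F) where
  carrier := {v | ∀ c ∈ C, v ⬝ᵥ c = 0}
  add_mem' := by
    intro a b ha hb c hc
    simp only [Set.mem_setOf_eq] at *
    rw [add_dotProduct, ha c hc, hb c hc, add_zero]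
  zero_mem' := by
    intro c hc
    simp
  smul_mem' := by
    intro a v hv c hc
    simp only [Set.mem_setOf_eq] at *
    rw [smul_dotProduct, hv c hc, smul_zero]

/-- The hull of a linear code: `Hull(C) = C ∩ C⊥`. -/
def hull (F : Type*) [Field F] {n : ℕ} (C : Submodule F (Fin n → F)) :
    Submodule F (Fin n → F) := C ⊓ dualCode F C

theorem mem_dualCode_span_range_row {F : Type*} [Field F] {k n : ℕ}
    (G : Matrix (Fin k) (Fin n) F) (v : Fin n → F) :
    v ∈ dualCode F (Submodule.span F (Set.range G.row)) ↔ G *ᵥ v = 0 := by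
  constructor
  · intro hv
    ext i
    rw [mulVec, dotProduct_comm]
    exact hv _ (Submodule.subset_span ⟨i, rfl⟩)
  · intro hv c hc
    rw [← range_vecMulLinear] at hc
    obtain ⟨x, rfl⟩ := hc
    rw [vecMulLinear_apply, dotProduct_comm, ← dotProduct_mulVec, hv, dotProduct_zero]

theorem hull_span_range_row {F : Type*} [Field F] {k n : ℕ} (G : Matrix (Fin k) (Fin n) F) :
    hull F (Submodule.span F (Set.range G.row)) =
      (LinearMap.ker (G * Gᵀ).mulVecLin).map G.vecMulLinear := by
  ext v
  rw [hull, Submodule.mem_inf, mem_dualCode_span_range_row, ← range_vecMulLinear]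
  simp only [LinearMap.mem_range, Submodule.mem_map, LinearMap.mem_ker, mulVecLin_apply,
    vecMulLinear_apply, ← mulVec_mulVec, mulVec_transpose]
  constructor
  · rintro ⟨⟨x, rfl⟩, hx⟩
    exact ⟨x, hx, rfl⟩
  · rintro ⟨x, hx, rfl⟩
    exact ⟨⟨x, rfl⟩, hx⟩

/-- If `G` is a `k × n` matrix over a finite field `F` with linearly
independent rows generating the code `C` (the row space of `G`), then
`dim Hull(C) = k - rank (G * Gᵀ)`. -/
theorem hull_dim_eq_sub_rank (F : Type*) [Field F] [Fintype F] {k n : ℕ}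
    (G : Matrix (Fin k) (Fin n) F)
    (hG : LinearIndependent F (fun i => G i))
    (C : Submodule F (Fin n → F))
    (hC : C = Submodule.span F (Set.range fun i => G i)) :
    Module.finrank F ↥(hull F C) = k - (G * Gᵀ).rank := by
  have hinj : Function.Injective G.vecMulLinear := vecMul_injective_iff.2 hG
  have hhull : hull F C = (LinearMap.ker (G * Gᵀ).mulVecLin).map G.vecMulLinear :=
    hC ▸ hull_span_range_row G
  have hrank := LinearMap.finrank_range_add_finrank_ker (G * Gᵀ).mulVecLin
  rw [Module.finrank_fin_fun] at hrank
  rw [hhull, ← (Submodule.equivMapOfInjective _ hinj _).finrank_eq, Matrix.rank]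
  omega
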